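/- Let S be a gcd-closed set of distinct positive integers satisfying condition 𝒢, let a be a positive integer, and let x_m ∈ S with G_S(x_m) = {x_{m₁}, x_{m₂}, x_{m₃}} consisting of exactly three elements; set x_{m_{ij}} := gcd(x_{m_i}, x_{m_j}) for 1 ≤ i < j ≤ 3 and x_{m₄} := gcd(x_{m₁}, x_{m₂}, x_{m₃}). Then, as rational numbers, x_m^{−a} − x_{m₁}^{−a} − x_{m₂}^{−a} − x_{m₃}^{−a} + x_{m_{12}}^{−a} + x_{m_{13}}^{−a} + x_{m_{23}}^{−a} − x_{m₄}^{−a} = ((x_m/x_{m₂})^a − 1)·((x_m/x_{m₁})^a − 1)·(x_{m₄}^a − (x_{m₁}·x_{m₂}/x_m)^a)·(1/(x_m^a·x_{m₄}^a)). -/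

import Mathlib

/-- Cofactors in `x` of two divisors with least common multiple `x` are coprime. -/
theorem coprime_cofactors_of_lcm_eq {x y z p q : ℕ} (hx : 0 < x) (hp : x = y * p)
    (hq : x = z * q) (h : Nat.lcm y z = x) : Nat.Coprime p q := by
  obtain ⟨p', hp'⟩ := Nat.gcd_dvd_left p q
  obtain ⟨q', hq'⟩ := Nat.gcd_dvd_right p q
  rw [Nat.Coprime]
  set d := Nat.gcd p q
  have hd : 0 < d := by
    rcases Nat.eq_zero_or_pos d with h0 | h0
    · rw [hp', h0] at hp
      simp at hp
      omega
    · exact h0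
  have hpq : y * p' = z * q' := by
    apply Nat.eq_of_mul_eq_mul_left hd
    calc d * (y * p') = y * p := by rw [hp']; ring
      _ = z * q := hp.symm.trans hq
      _ = d * (z * q') := by rw [hq']; ring
  have hxd : x = y * p' * d := by rw [hp, hp']; ring
  have hdvd : x ∣ y * p' := by
    rw [← h]
    exact Nat.lcm_dvd (Dvd.intro _ rfl) (hpq ▸ Dvd.intro _ rfl)
  have hpos : 0 < y * p' := by
    rcases Nat.eq_zero_or_pos (y * p') with h0 | h0
    · rw [h0] at hxd
      omega
    · exact h0
  have hle := Nat.le_of_dvd hpos hdvd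
  nlinarith

/-- Three divisors of `x` whose pairwise least common multiples are all `x` have the form
`g * q * r`, `g * p * r`, `g * p * q` with `p`, `q`, `r` pairwise coprime and
`x = g * p * q * r`. -/
theorem exists_factorization_of_lcm_eq {x y₁ y₂ y₃ : ℕ} (hx : 0 < x)
    (h₁₂ : Nat.lcm y₁ y₂ = x) (h₁₃ : Nat.lcm y₁ y₃ = x) (h₂₃ : Nat.lcm y₂ y₃ = x) :
    ∃ g p q r : ℕ, Nat.Coprime p q ∧ Nat.Coprime p r ∧ Nat.Coprime q r ∧
      x = g * p * q * r ∧ y₁ = g * q * r ∧ y₂ = g * p * r ∧ y₃ = g * p * q := by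
  obtain ⟨p, hp⟩ : y₁ ∣ x := h₁₂ ▸ Nat.dvd_lcm_left y₁ y₂
  obtain ⟨q, hq⟩ : y₂ ∣ x := h₁₂ ▸ Nat.dvd_lcm_right y₁ y₂
  obtain ⟨r, hr⟩ : y₃ ∣ x := h₁₃ ▸ Nat.dvd_lcm_right y₁ y₃
  have hpq := coprime_cofactors_of_lcm_eq hx hp hq h₁₂
  have hpr := coprime_cofactors_of_lcm_eq hx hp hr h₁₃
  have hqr := coprime_cofactors_of_lcm_eq hx hq hr h₂₃
  have hdvd : p * q * r ∣ x :=
    (hpr.mul_left hqr).mul_dvd_of_dvd_of_dvd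
      (hpq.mul_dvd_of_dvd_of_dvd ⟨y₁, by rw [hp, mul_comm]⟩ ⟨y₂, by rw [hq, mul_comm]⟩)
      ⟨y₃, by rw [hr, mul_comm]⟩
  obtain ⟨g, hg⟩ := hdvd
  have hp0 : 0 < p := Nat.pos_of_ne_zero (by rintro rfl; simp at hp; omega)
  have hq0 : 0 < q := Nat.pos_of_ne_zero (by rintro rfl; simp at hq; omega)
  have hr0 : 0 < r := Nat.pos_of_ne_zero (by rintro rfl; simp at hr; omega)
  refine ⟨g, p, q, r, hpq, hpr, hqr, by rw [hg]; ring, ?_, ?_, ?_⟩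
  · exact Nat.eq_of_mul_eq_mul_right hp0 (by rw [← hp, hg]; ring)
  · exact Nat.eq_of_mul_eq_mul_right hq0 (by rw [← hq, hg]; ring)
  · exact Nat.eq_of_mul_eq_mul_right hr0 (by rw [← hr, hg]; ring)


open Finset

def gcdClosed (S : Finset ℕ) : Prop := ∀ x ∈ S, ∀ y ∈ S, Nat.gcd x y ∈ S

/-- The set of greatest-type divisors of `x` in `S`. -/
def GTD (S : Finset ℕ) (x : ℕ) : Finset ℕ :=
  S.filter fun d => d < x ∧ d ∣ x ∧ ∀ y ∈ S, d ∣ y → y ∣ x → y = d ∨ y = x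

/-- The element `x` satisfies condition 𝒢 with respect to `S`. -/
def condGAt (S : Finset ℕ) (x : ℕ) : Prop :=
  ∀ y₁ ∈ GTD S x, ∀ y₂ ∈ GTD S x, y₁ ≠ y₂ →
    Nat.lcm y₁ y₂ = x ∧ Nat.gcd y₁ y₂ ∈ GTD S y₁ ∧ Nat.gcd y₁ y₂ ∈ GTD S y₂

/-- The set `S` satisfies condition 𝒢. -/
def condG (S : Finset ℕ) : Prop := ∀ x ∈ S, condGAt S x

/-- `c_{ij}`: the sum of `μ(d)` over positive integers `d` with `d·x_i ∣ x_j` and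
`d·x_i ∤ x_t` for every `x_t ∈ S` with `x_t < x_j`. -/
def cMat {n : ℕ} (x : Fin n → ℕ) (i j : Fin n) : ℤ :=
  ∑ d ∈ (x j).divisors.filter
      (fun d => d * x i ∣ x j ∧ ∀ t : Fin n, x t < x j → ¬ d * x i ∣ x t),
    ArithmeticFunction.moebius d

/-- `α_{ξ_a}(x_k)`: the sum of `(ξ_a * μ)(d)` over divisors `d` of `x_k` with
`d ∤ x_t` for every `x_t ∈ S` with `x_t < x_k`. -/
def alphaXi {n : ℕ} (a : ℕ) (x : Fin n → ℕ) (k : Fin n) : ℤ :=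
  ∑ d ∈ (x k).divisors.filter (fun d => ∀ t : Fin n, x t < x k → ¬ d ∣ x t),
    ∑ e ∈ d.divisors, (e : ℤ) ^ a * ArithmeticFunction.moebius (d / e)

/-- `α_{1/ξ_a}(x_k)`: the sum of `((1/ξ_a) * μ)(d)` over divisors `d` of `x_k` with
`d ∤ x_t` for every `x_t ∈ S` with `x_t < x_k`. -/
def alphaInvXi {n : ℕ} (a : ℕ) (x : Fin n → ℕ) (k : Fin n) : ℚ :=
  ∑ d ∈ (x k).divisors.filter (fun d => ∀ t : Fin n, x t < x k → ¬ d ∣ x t),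
    ∑ e ∈ d.divisors, ((e : ℚ) ^ a)⁻¹ * ((ArithmeticFunction.moebius (d / e) : ℤ) : ℚ)
theorem alpha_inv_factorization_rat
    (S : Finset ℕ) (hpos : ∀ u ∈ S, 0 < u) (hgcd : gcdClosed S) (hG : condG S)
    (a : ℕ) (ha : 0 < a)
    (xm y₁ y₂ y₃ : ℕ) (hm : xm ∈ S)
    (hGTD : GTD S xm = {y₁, y₂, y₃}) (hcard : ({y₁, y₂, y₃} : Finset ℕ).card = 3) :
    (xm : ℚ) ^ (-(a : ℤ)) - (y₁ : ℚ) ^ (-(a : ℤ)) - (y₂ : ℚ) ^ (-(a : ℤ))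
      - (y₃ : ℚ) ^ (-(a : ℤ)) + (Nat.gcd y₁ y₂ : ℚ) ^ (-(a : ℤ))
      + (Nat.gcd y₁ y₃ : ℚ) ^ (-(a : ℤ)) + (Nat.gcd y₂ y₃ : ℚ) ^ (-(a : ℤ))
      - (Nat.gcd (Nat.gcd y₁ y₂) y₃ : ℚ) ^ (-(a : ℤ)) =
    (((xm : ℚ) / (y₂ : ℚ)) ^ a - 1) * (((xm : ℚ) / (y₁ : ℚ)) ^ a - 1) *
      ((Nat.gcd (Nat.gcd y₁ y₂) y₃ : ℚ) ^ a - ((y₁ : ℚ) * (y₂ : ℚ) / (xm : ℚ)) ^ a) *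
      (1 / ((xm : ℚ) ^ a * (Nat.gcd (Nat.gcd y₁ y₂) y₃ : ℚ) ^ a)) := by
  have hne : y₁ ≠ y₂ ∧ y₁ ≠ y₃ ∧ y₂ ≠ y₃ := by
    refine ⟨?_, ?_, ?_⟩ <;> rintro rfl <;>
      simp only [mem_insert, mem_singleton, true_or, or_true, insert_eq_of_mem] at hcard <;>
      exact absurd hcard (Finset.card_le_two.trans_lt (by norm_num)).ne
  have hx := hpos xm hm
  have hlcm : ∀ y ∈ ({y₁, y₂, y₃} : Finset ℕ), ∀ z ∈ ({y₁, y₂, y₃} : Finset ℕ), y ≠ z →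
      Nat.lcm y z = xm := fun y hy z hz hyz =>
    (hG xm hm y (hGTD ▸ hy) z (hGTD ▸ hz) hyz).1
  obtain ⟨g, p, q, r, hpq, hpr, hqr, rfl, rfl, rfl, rfl⟩ := exists_factorization_of_lcm_eq hx
    (hlcm y₁ (by simp) y₂ (by simp) hne.1) (hlcm y₁ (by simp) y₃ (by simp) hne.2.1)
    (hlcm y₂ (by simp) y₃ (by simp) hne.2.2)
  have h₁₂ : Nat.gcd (g * q * r) (g * p * r) = g * r := by
    rw [Nat.gcd_mul_right, Nat.gcd_mul_left, hpq.symm.gcd_eq_one, mul_one]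
  have h₁₃ : Nat.gcd (g * q * r) (g * p * q) = g * q := by
    rw [mul_right_comm g q r, Nat.gcd_mul_right, Nat.gcd_mul_left, hpr.symm.gcd_eq_one, mul_one]
  have h₂₃ : Nat.gcd (g * p * r) (g * p * q) = g * p := by
    rw [Nat.gcd_mul_left, hqr.symm.gcd_eq_one, mul_one]
  have h₁₂₃ : Nat.gcd (g * r) (g * p * q) = g := by
    rw [mul_assoc g p q, Nat.gcd_mul_left, (hpr.symm.mul_right hqr.symm).gcd_eq_one, mul_one]
  rw [h₁₂, h₁₃, h₂₃, h₁₂₃]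
  have hg0 : (g : ℚ) ≠ 0 := by rintro h; simp_all
  have hp0 : (p : ℚ) ≠ 0 := by rintro h; simp_all
  have hq0 : (q : ℚ) ≠ 0 := by rintro h; simp_all
  have hr0 : (r : ℚ) ≠ 0 := by rintro h; simp_all
  push_cast
  simp only [zpow_neg, zpow_natCast, mul_pow, div_pow]
  field_simp
  ring
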